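/- arXiv:1909.00019 — 2 statements merged into one kernel-verified Lean document; each statement's English description precedes it below -/
import Mathlib

section
/- Let P_k be the path graph on k vertices, with k ≥ 3. Then the number n(P_k) of words of minimal length ℓ(P_k) = 2k − 2 that word-represent P_k equals (k + 1) · 2^{k−3}. -/
variable {V : Type*}

/-- The restriction of a word `w` to the letters `x` and `y`. -/
def restrictWord [DecidableEq V] (w : List V) (x y : V) : List V :=
  w.filter fun z => decide (z = x ∨ z = y)

/-- `x` and `y` alternate in `w`: the restriction of `w` to `{x, y}` has no two
consecutive equal letters. -/
def Alternates [DecidableEq V] (w : List V) (x y : V) : Prop :=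
  (restrictWord w x y).Chain' (· ≠ ·)

/-- `w` word-represents the simple graph `G`: every vertex occurs in `w`, and two distinct
vertices are adjacent iff they alternate in `w`. -/
def Represents [DecidableEq V] (G : SimpleGraph V) (w : List V) : Prop :=
  (∀ v : V, v ∈ w) ∧ ∀ x y : V, x ≠ y → (G.Adj x y ↔ Alternates w x y)

/-- `ℓ(G)`: the minimal length of a word-representant of `G`. -/
noncomputable def minRepLength [DecidableEq V] (G : SimpleGraph V) : ℕ :=
  sInf {n | ∃ w : List V, Represents G w ∧ w.length = n}

/-- The path graph `P_k` on vertex set `Fin k`, with an edge between consecutive vertices. -/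
def pathGraph' (k : ℕ) : SimpleGraph (Fin k) :=
  SimpleGraph.fromRel fun i j => (i : ℕ) + 1 = (j : ℕ)

lemma alt_comm (w : List ℕ) (x y : ℕ) : Alternates w x y ↔ Alternates w y x := by
  unfold Alternates restrictWord
  simp only [or_comm]

lemma alt_map {U V : Type*} [DecidableEq U] [DecidableEq V] (f : U → V)
    (hf : Function.Injective f) (w : List U) (x y : U) :
    Alternates (w.map f) (f x) (f y) ↔ Alternates w x y := by
  unfold Alternates restrictWord
  rw [List.filter_map]
  simp only [List.Chain', List.isChain_map, Function.comp_def, hf.eq_iff, hf.ne_iff]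

lemma alt_infix {w M : List ℕ} (h : M <:+: w) {x y : ℕ} (ha : Alternates w x y) :
    Alternates M x y := by
  unfold Alternates restrictWord at *
  exact List.IsChain.infix ha (h.filter _)

lemma restrict_not_mem {M : List ℕ} {x y : ℕ} (h : y ∉ M) :
    restrictWord M x y = List.replicate (M.count x) x := by
  unfold restrictWord
  rw [← List.filter_eq]
  apply List.filter_congr
  intro z hz
  have : z ≠ y := fun e => h (e ▸ hz)
  simp [this, eq_comm]

lemma alt_count {M : List ℕ} {x y : ℕ} (h : y ∉ M) (ha : Alternates M x y) :
    M.count x ≤ 1 := by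
  unfold Alternates at ha
  rw [restrict_not_mem h] at ha
  rcases hc : M.count x with _ | _ | n
  · omega
  · omega
  · rw [hc] at ha
    simp [List.replicate_succ, List.Chain'] at ha

lemma alt_single {w : List ℕ} {x y : ℕ} (hx : w.count x = 1) (hy : w.count y = 1) :
    Alternates w x y := by
  unfold Alternates
  have : (restrictWord w x y).Nodup := by
    rw [List.nodup_iff_count_le_one]
    intro z
    by_cases hz : z = x ∨ z = y
    · refine (List.Sublist.count_le z List.filter_sublist).trans ?_
      rcases hz with rfl | rfl <;> omega
    · rw [List.count_eq_zero_of_not_mem]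
      · omega
      · unfold restrictWord; simp [hz]
  exact List.Pairwise.isChain this

lemma chain_form (a m b x k : ℕ) (h : x ≠ k) :
    List.IsChain (· ≠ ·) (List.replicate a x ++ k :: (List.replicate m x ++ k :: List.replicate b x))
      ↔ a ≤ 1 ∧ m = 1 ∧ b ≤ 1 := by
  rcases a with _ | _ | a <;> rcases m with _ | _ | m <;> rcases b with _ | _ | b <;>
    simp [List.replicate_succ, h, h.symm]

lemma alt_form {A M B : List ℕ} {x k : ℕ} (h : x ≠ k) (hA : k ∉ A) (hM : k ∉ M) (hB : k ∉ B) :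
    Alternates (A ++ k :: (M ++ k :: B)) x k ↔
      A.count x ≤ 1 ∧ M.count x = 1 ∧ B.count x ≤ 1 := by
  rw [← chain_form _ _ _ x k h, ← restrict_not_mem hA, ← restrict_not_mem hM,
    ← restrict_not_mem hB]
  unfold Alternates restrictWord
  simp [List.Chain']

def PP (k : ℕ) (w : List ℕ) : Prop :=
  (∀ x, x ∈ w ↔ x < k) ∧
    ∀ x y, x < k → y < k → x ≠ y → ((x + 1 = y ∨ y + 1 = x) ↔ Alternates w x y)

lemma len_eq {k : ℕ} {w : List ℕ} (h : ∀ x ∈ w, x < k) :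
    w.length = ∑ x ∈ Finset.range k, w.count x := by
  have := Multiset.sum_count_eq_card (s := Finset.range k) (m := (w : Multiset ℕ))
    (by simpa using h)
  simpa using this.symm

lemma singles_card {k : ℕ} {w : List ℕ} (h : PP k w) :
    ((Finset.range k).filter (fun x => w.count x = 1)).card ≤ 2 := by
  by_contra hc
  rw [not_le, Finset.two_lt_card] at hc
  obtain ⟨a, ha, b, hb, c, hc, hab, hac, hbc⟩ := hc
  simp only [Finset.mem_filter, Finset.mem_range] at ha hb hc
  have h1 := (h.2 a b ha.1 hb.1 hab).2 (alt_single ha.2 hb.2)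
  have h2 := (h.2 a c ha.1 hc.1 hac).2 (alt_single ha.2 hc.2)
  have h3 := (h.2 b c hb.1 hc.1 hbc).2 (alt_single hb.2 hc.2)
  omega

lemma len_aux {k : ℕ} {w : List ℕ} :
    ∑ x ∈ Finset.range k, (if w.count x = 1 then 1 else 2) +
      ((Finset.range k).filter (fun x => w.count x = 1)).card = 2 * k := by
  rw [Finset.card_filter, ← Finset.sum_add_distrib]
  rw [Finset.sum_congr rfl (g := fun _ => 2)]
  · simp [mul_comm]
  · intro x _
    split_ifs <;> rfl

lemma term_le {k : ℕ} {w : List ℕ} (h : PP k w) :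
    ∀ x ∈ Finset.range k, (if w.count x = 1 then 1 else 2) ≤ w.count x := by
  intro x hx
  have := List.count_pos_iff.2 ((h.1 x).2 (Finset.mem_range.1 hx))
  split_ifs <;> omega

lemma len_ge {k : ℕ} {w : List ℕ} (h : PP k w) : 2 * k - 2 ≤ w.length := by
  rw [len_eq (fun x hx => (h.1 x).1 hx)]
  have h1 := Finset.sum_le_sum (term_le h)
  have h2 := singles_card h
  have h3 := @len_aux k w
  omega

lemma structure_counts {k : ℕ} (hk : 2 ≤ k) {w : List ℕ} (h : PP k w)
    (hl : w.length = 2 * k - 2) :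
    (∀ x, x < k → w.count x = 1 ∨ w.count x = 2) ∧
    ∃ i, i + 1 < k ∧ ∀ x, x < k → (w.count x = 1 ↔ x = i ∨ x = i + 1) := by
  have h0 := len_eq (fun x hx => (h.1 x).1 hx)
  have h1 := Finset.sum_le_sum (term_le h)
  have h2 := singles_card h
  have h3 := @len_aux k w
  have h4 : ((Finset.range k).filter (fun x => w.count x = 1)).card = 2 := by omega
  have h5 : ∑ x ∈ Finset.range k, (if w.count x = 1 then 1 else 2) =
      ∑ x ∈ Finset.range k, w.count x := by omega
  rw [Finset.sum_eq_sum_iff_of_le (term_le h)] at h5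
  refine ⟨fun x hx => ?_, ?_⟩
  · have := h5 x (Finset.mem_range.2 hx)
    split_ifs at this <;> omega
  · rw [Finset.card_eq_two] at h4
    obtain ⟨a, b, hab, he⟩ := h4
    have key : ∀ x, (x < k ∧ w.count x = 1) ↔ x = a ∨ x = b := by
      intro x
      have := Finset.ext_iff.1 he x
      simpa using this
    have ha := (key a).2 (Or.inl rfl)
    have hb := (key b).2 (Or.inr rfl)
    rcases (h.2 a b ha.1 hb.1 hab).2 (alt_single ha.2 hb.2) with e | e
    · refine ⟨a, by omega, fun x hx => ?_⟩
      have := key x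
      rw [e]; tauto
    · refine ⟨b, by omega, fun x hx => ?_⟩
      have := key x
      rw [e]; tauto

lemma decomp_two {w : List ℕ} {n : ℕ} (h : w.count n = 2) :
    ∃ A M B, w = A ++ n :: (M ++ n :: B) ∧ n ∉ A ∧ n ∉ M ∧ n ∉ B := by
  obtain ⟨A, C, rfl, hA⟩ := List.eq_append_cons_of_mem
    (List.count_pos_iff.1 (by omega : 0 < w.count n))
  have hA0 := List.count_eq_zero_of_not_mem hA
  simp [hA0] at h
  obtain ⟨M, B, rfl, hM⟩ := List.eq_append_cons_of_mem
    (List.count_pos_iff.1 (by omega : 0 < C.count n))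
  have hM0 := List.count_eq_zero_of_not_mem hM
  simp [hM0] at h
  exact ⟨A, M, B, rfl, hA, hM, List.count_eq_zero.1 h⟩

lemma alt_del {A B : List ℕ} {x y n e : ℕ} (hx : x ≠ n) (hy : y ≠ n) :
    Alternates (A ++ n :: e :: n :: B) x y ↔ Alternates (A ++ e :: B) x y := by
  unfold Alternates restrictWord
  have : (A ++ n :: e :: n :: B).filter (fun z => decide (z = x ∨ z = y)) =
      (A ++ e :: B).filter (fun z => decide (z = x ∨ z = y)) := by
    simp [List.filter_cons, hx.symm, hy.symm]
  rw [this]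

lemma middle_eq {k : ℕ} {A M B : List ℕ}
    (h : PP (k + 2) (A ++ (k + 1) :: (M ++ (k + 1) :: B)))
    (hl : (A ++ (k + 1) :: (M ++ (k + 1) :: B)).length = 2 * (k + 2) - 2)
    (hA : k + 1 ∉ A) (hM : k + 1 ∉ M) (hB : k + 1 ∉ B) : M = [k] := by
  set w := A ++ (k + 1) :: (M ++ (k + 1) :: B) with hw
  obtain ⟨hc, i, hi, hs⟩ := structure_counts (by omega) h hl
  have hcount : ∀ x, x ≠ k + 1 → w.count x = A.count x + M.count x + B.count x := by
    intro x hx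
    simp [hw, List.count_cons, hx.symm]
    omega
  have hinf : M <:+: w := ⟨A ++ [k + 1], (k + 1) :: B, by simp [hw]⟩
  have hMk : M.count k = 1 :=
    ((alt_form (by omega) hA hM hB).1 ((h.2 k (k + 1) (by omega) (by omega) (by omega)).1
      (Or.inl rfl))).2.1
  have hne : ∀ x, x < k → M.count x ≠ 1 := by
    intro x hx h1
    have h2 := hcount x (by omega)
    have h3 := hc x (by omega)
    have := (h.2 x (k + 1) (by omega) (by omega) (by omega)).2
      ((alt_form (by omega) hA hM hB).2 ⟨by omega, h1, by omega⟩)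
    omega
  have hk1 : w.count (k + 1) = 2 := by
    simp [hw, List.count_eq_zero_of_not_mem hA, List.count_eq_zero_of_not_mem hM,
      List.count_eq_zero_of_not_mem hB]
  have hik : i < k := by
    by_contra hcon
    have := (hs (k + 1) (by omega)).2 (by omega)
    omega
  have hi0 : M.count i = 0 := by
    have h1 := (hs i (by omega)).2 (Or.inl rfl)
    have h2 := hcount i (by omega)
    have := hne i hik
    omega
  have step : ∀ x y, x < k → y < k → (x + 1 = y ∨ y + 1 = x) → M.count y = 0 →
      M.count x = 0 := by
    intro x y hx hy hxy h0
    have := alt_count (List.count_eq_zero.1 h0)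
      (alt_infix hinf ((h.2 x y (by omega) (by omega) (by omega)).1 hxy))
    have := hne x hx
    omega
  have up : ∀ d, i + d < k → M.count (i + d) = 0 := by
    intro d
    induction d with
    | zero => intro _; exact hi0
    | succ d ih =>
      intro hd
      exact step _ (i + d) hd (by omega) (by omega) (ih (by omega))
  have down : ∀ d, d ≤ i → M.count (i - d) = 0 := by
    intro d
    induction d with
    | zero => intro _; exact hi0
    | succ d ih =>
      intro hd
      exact step _ (i - d) (by omega) (by omega) (by omega) (ih (by omega))
  have hall : ∀ x, x < k → M.count x = 0 := by
    intro x hx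
    by_cases hxi : i ≤ x
    · have := up (x - i) (by omega)
      rwa [show i + (x - i) = x by omega] at this
    · have := down (i - x) (by omega)
      rwa [show i - (i - x) = x by omega] at this
  have hlet : ∀ x ∈ M, x = k := by
    intro x hx
    have h1 : x < k + 2 := (h.1 x).1 (hinf.subset hx)
    have h2 : x ≠ k + 1 := fun e => hM (e ▸ hx)
    have h3 : ¬ x < k := fun hlt => (List.count_eq_zero.1 (hall x hlt)) hx
    omega
  have := List.eq_replicate_of_mem hlet
  rw [this] at hMk
  simp at hMk
  rw [this, hMk]
  rfl

def ext (e n : ℕ) : List ℕ → List (List ℕ)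
  | [] => []
  | a :: w => (if a = e then [n :: e :: n :: w] else []) ++ (ext e n w).map (fun v => a :: v)

lemma mem_ext {e n : ℕ} {w v : List ℕ} :
    v ∈ ext e n w ↔ ∃ A B, w = A ++ e :: B ∧ v = A ++ n :: e :: n :: B := by
  induction w generalizing v with
  | nil => simp [ext]
  | cons a w ih =>
    simp only [ext, List.mem_append, List.mem_map, ih]
    constructor
    · rintro (h | ⟨_, ⟨A, B, rfl, rfl⟩, rfl⟩)
      · split_ifs at h with ha
        · subst ha
          exact ⟨[], w, rfl, by simpa using h⟩
        · simp at h
      · exact ⟨a :: A, B, rfl, rfl⟩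
    · rintro ⟨A, B, hw, rfl⟩
      rcases A with _ | ⟨c, A⟩
      · simp at hw
        left
        simp [hw.1, hw.2]
      · simp at hw
        right
        exact ⟨_, ⟨A, B, hw.2, rfl⟩, by simp [hw.1]⟩

lemma length_ext (e n : ℕ) (w : List ℕ) : (ext e n w).length = w.count e := by
  induction w with
  | nil => simp [ext]
  | cons a w ih =>
    by_cases h : a = e <;> simp [ext, ih, h, add_comm]

lemma nodup_ext {e n : ℕ} {w : List ℕ} (h : n ∉ w) : (ext e n w).Nodup := by
  induction w with
  | nil => simp [ext]
  | cons a w ih =>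
    simp only [List.mem_cons, not_or] at h
    have h2 : ((ext e n w).map (fun v => a :: v)).Nodup :=
      (ih h.2).map (fun x y hxy => by simpa using hxy)
    unfold ext
    split_ifs with ha
    · rw [List.singleton_append, List.nodup_cons]
      refine ⟨?_, h2⟩
      simp only [List.mem_map, not_exists, not_and]
      intro v _ hv
      simp at hv
      exact h.1 hv.1.symm
    · simpa using h2

lemma ext_del {e n : ℕ} {w v : List ℕ} (hen : e ≠ n) (h : n ∉ w) (hv : v ∈ ext e n w) :
    v.filter (fun z => decide (z ≠ n)) = w := by
  obtain ⟨A, B, rfl, rfl⟩ := mem_ext.1 hv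
  have : (A ++ e :: B).filter (fun z => decide (z ≠ n)) = A ++ e :: B := by
    rw [List.filter_eq_self]
    intro z hz
    simp
    exact fun e => h (e ▸ hz)
  conv_rhs => rw [← this]
  simp [List.filter_cons]

lemma fin_words (k n : ℕ) : {w : List ℕ | PP k w ∧ w.length = n}.Finite := by
  refine ((List.finite_length_eq (Fin k) n).image (List.map Fin.val)).subset ?_
  rintro w ⟨h, hl⟩
  refine ⟨w.pmap (fun x hx => ⟨x, hx⟩) (fun x hx => (h.1 x).1 hx), ?_, ?_⟩
  · simpa using hl
  · simp [List.map_pmap]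

noncomputable def WW (k : ℕ) : Finset (List ℕ) := (fin_words k (2 * k - 2)).toFinset

lemma mem_WW {k : ℕ} {w : List ℕ} : w ∈ WW k ↔ PP k w ∧ w.length = 2 * k - 2 := by
  simp [WW]

lemma ext_mem_WW {k : ℕ} {w v : List ℕ} (hw : w ∈ WW (k + 2)) (hv : v ∈ ext (k + 1) (k + 2) w) :
    v ∈ WW (k + 3) ∧ v.count (k + 2) = 2 := by
  rw [mem_WW] at hw
  obtain ⟨h, hl⟩ := hw
  obtain ⟨hc, -⟩ := structure_counts (by omega) h hl
  obtain ⟨A, B, rfl, rfl⟩ := mem_ext.1 hv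
  have hn : k + 2 ∉ A ++ (k + 1) :: B := fun hm => by
    have := (h.1 _).1 hm
    omega
  have hA : k + 2 ∉ A := fun hm => hn (by simp [hm])
  have hB : k + 2 ∉ B := fun hm => hn (by simp [hm])
  have hform : ∀ x, x < k + 2 → ((x + 1 = k + 2 ∨ k + 2 + 1 = x) ↔
      Alternates (A ++ (k + 2) :: (k + 1) :: (k + 2) :: B) x (k + 2)) := by
    intro x hx
    have := alt_form (A := A) (M := [k + 1]) (B := B) (x := x) (k := k + 2) (by omega) hA
      (by simp) hB
    simp only [List.singleton_append] at this
    rw [this]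
    by_cases hxk : x = k + 1
    · subst hxk
      have := hc (k + 1) (by omega)
      simp at this
      simp
      omega
    · have : List.count x [k + 1] = 0 := by
        rw [List.count_eq_zero]; simp [hxk]
      omega
  refine ⟨mem_WW.2 ⟨⟨?_, ?_⟩, ?_⟩, ?_⟩
  · intro x
    have := h.1 x
    simp at this ⊢
    grind
  · intro x y hx hy hxy
    by_cases hxn : x = k + 2
    · subst hxn
      rw [alt_comm, or_comm]
      exact hform y (by omega)
    · by_cases hyn : y = k + 2
      · subst hyn
        exact hform x (by omega)
      · rw [alt_del hxn hyn]
        exact h.2 x y (by omega) (by omega) hxy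
  · simp at hl ⊢
    omega
  · simp [List.count_eq_zero_of_not_mem hA, List.count_eq_zero_of_not_mem hB, List.count_cons]

lemma exists_ext {k : ℕ} {v : List ℕ} (hv : v ∈ WW (k + 3)) (h2 : v.count (k + 2) = 2) :
    ∃ w ∈ WW (k + 2), v ∈ ext (k + 1) (k + 2) w := by
  rw [mem_WW] at hv
  obtain ⟨h, hl⟩ := hv
  obtain ⟨A, M, B, rfl, hA, hM, hB⟩ := decomp_two h2
  obtain rfl := middle_eq h hl hA hM hB
  simp only [List.singleton_append] at *
  refine ⟨A ++ (k + 1) :: B, mem_WW.2 ⟨⟨?_, ?_⟩, ?_⟩, mem_ext.2 ⟨A, B, rfl, rfl⟩⟩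
  · intro x
    have := h.1 x
    simp at this ⊢
    grind
  · intro x y hx hy hxy
    rw [← alt_del (n := k + 2) (by omega) (by omega)]
    exact h.2 x y (by omega) (by omega) hxy
  · simp at hl ⊢
    omega

lemma card_rec (k : ℕ) (p : List ℕ → Prop) [DecidablePred p]
    (hp : ∀ w v, v ∈ ext (k + 1) (k + 2) w → (p v ↔ p w)) :
    ((WW (k + 3)).filter (fun v => v.count (k + 2) = 2 ∧ p v)).card =
      ∑ w ∈ (WW (k + 2)).filter p, w.count (k + 1) := by
  have hn : ∀ w ∈ WW (k + 2), k + 2 ∉ w := by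
    intro w hw hm
    have := ((mem_WW.1 hw).1.1 _).1 hm
    omega
  have : (WW (k + 3)).filter (fun v => v.count (k + 2) = 2 ∧ p v) =
      ((WW (k + 2)).filter p).biUnion (fun w => (ext (k + 1) (k + 2) w).toFinset) := by
    ext v
    simp only [Finset.mem_filter, Finset.mem_biUnion, List.mem_toFinset]
    constructor
    · rintro ⟨h1, h2, h3⟩
      obtain ⟨w, hw, hwv⟩ := exists_ext h1 h2
      exact ⟨w, ⟨hw, (hp w v hwv).1 h3⟩, hwv⟩
    · rintro ⟨w, ⟨hw, hpw⟩, hwv⟩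
      obtain ⟨h1, h2⟩ := ext_mem_WW hw hwv
      exact ⟨h1, h2, (hp w v hwv).2 hpw⟩
  rw [this, Finset.card_biUnion]
  · apply Finset.sum_congr rfl
    intro w hw
    rw [List.toFinset_card_of_nodup (nodup_ext (hn w (Finset.mem_filter.1 hw).1)), length_ext]
  · intro w hw w' hw' hne
    simp only [Function.onFun]
    rw [Finset.disjoint_left]
    intro v hv hv'
    rw [List.mem_toFinset] at hv hv'
    apply hne
    rw [← ext_del (by omega) (hn w (Finset.mem_filter.1 hw).1) hv,
      ← ext_del (by omega) (hn w' (Finset.mem_filter.1 hw').1) hv']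

noncomputable def DD (k : ℕ) : ℕ := ((WW (k + 2)).filter (fun v => v.count (k + 1) = 2)).card
noncomputable def SS (k : ℕ) : ℕ := ((WW (k + 2)).filter (fun v => v.count (k + 1) = 1)).card
noncomputable def FF (k : ℕ) : ℕ := ((WW (k + 2)).filter (fun v => v.count 0 = 1)).card

lemma WW_counts {k : ℕ} {w : List ℕ} (h : w ∈ WW (k + 2)) :
    w.count (k + 1) = 1 ∨ w.count (k + 1) = 2 :=
  (structure_counts (by omega) (mem_WW.1 h).1 (mem_WW.1 h).2).1 _ (by omega)

lemma first_last {k : ℕ} {w : List ℕ} (h : w ∈ WW (k + 3)) (h0 : w.count 0 = 1) :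
    w.count (k + 2) = 2 := by
  obtain ⟨hc, i, hi, hs⟩ := structure_counts (by omega) (mem_WW.1 h).1 (mem_WW.1 h).2
  have h1 := (hs 0 (by omega)).1 h0
  have h2 := hs (k + 2) (by omega)
  have h3 := hc (k + 2) (by omega)
  omega

lemma card_WW (k : ℕ) : (WW (k + 2)).card = SS k + DD k := by
  unfold SS DD
  rw [← Finset.card_union_of_disjoint, ← Finset.filter_or, Finset.filter_true_of_mem]
  · intro w hw
    exact WW_counts hw
  · rw [Finset.disjoint_filter]
    intros; omega

lemma DD_succ (k : ℕ) : DD (k + 1) = SS k + 2 * DD k := by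
  have := card_rec k (fun _ => True) (by simp)
  simp only [and_true, Finset.filter_true] at this
  unfold DD SS
  rw [show k + 1 + 2 = k + 3 by omega, show k + 1 + 1 = k + 2 by omega, this,
    Finset.card_filter, Finset.card_filter, Finset.mul_sum, ← Finset.sum_add_distrib]
  apply Finset.sum_congr rfl
  intro w hw
  rcases WW_counts hw with h | h <;> simp [h]

lemma FF_rec (k : ℕ) :
    FF (k + 1) = ∑ w ∈ (WW (k + 2)).filter (fun v => v.count 0 = 1), w.count (k + 1) := by
  rw [← card_rec k (fun v => v.count 0 = 1)]
  · unfold FF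
    congr 1
    apply Finset.filter_congr
    intro w hw
    exact ⟨fun h => ⟨first_last hw h, h⟩, fun h => h.2⟩
  · intro w v hv
    obtain ⟨A, B, rfl, rfl⟩ := mem_ext.1 hv
    simp [List.count_cons]

lemma FF_succ (k : ℕ) : FF (k + 2) = 2 * FF (k + 1) := by
  rw [FF_rec, Finset.sum_congr rfl (g := fun _ => 2)]
  · simp [FF, mul_comm]
  · intro w hw
    rw [Finset.mem_filter] at hw
    exact first_last hw.1 hw.2

def rv (k x : ℕ) : ℕ := if x < k then k - 1 - x else x

lemma rv_rv (k x : ℕ) : rv k (rv k x) = x := by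
  unfold rv; split_ifs <;> omega

lemma rv_inj (k : ℕ) : Function.Injective (rv k) :=
  Function.LeftInverse.injective (rv_rv k)

lemma rv_mem {k : ℕ} {w : List ℕ} (h : w ∈ WW k) : w.map (rv k) ∈ WW k := by
  rw [mem_WW] at *
  obtain ⟨⟨h1, h2⟩, hl⟩ := h
  refine ⟨⟨?_, ?_⟩, by simpa using hl⟩
  · intro x
    rw [← rv_rv k x, List.mem_map_of_injective (rv_inj k), h1]
    unfold rv; split_ifs <;> omega
  · intro x y hx hy hxy
    have := alt_map (rv k) (rv_inj k) w (rv k x) (rv k y)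
    rw [rv_rv, rv_rv] at this
    rw [this, ← h2]
    · unfold rv; simp only [hx, hy, if_true]; omega
    · unfold rv; split_ifs; omega
    · unfold rv; split_ifs; omega
    · exact (rv_inj k).ne hxy

lemma SS_eq_FF (k : ℕ) : SS k = FF k := by
  unfold SS FF
  have hm : ∀ w : List ℕ, (w.map (rv (k + 2))).map (rv (k + 2)) = w := by
    intro w
    simp [Function.comp_def, rv_rv]
  have e0 : rv (k + 2) 0 = k + 1 := by simp [rv]
  have e1 : rv (k + 2) (k + 1) = 0 := by simp [rv]
  refine Finset.card_bij' (fun w _ => w.map (rv (k + 2))) (fun w _ => w.map (rv (k + 2)))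
    ?_ ?_ (fun w _ => hm w) (fun w _ => hm w)
  · intro w hw
    rw [Finset.mem_filter] at *
    refine ⟨rv_mem hw.1, ?_⟩
    rw [← e1, List.count_map_of_injective _ _ (rv_inj _)]
    exact hw.2
  · intro w hw
    rw [Finset.mem_filter] at *
    refine ⟨rv_mem hw.1, ?_⟩
    rw [← e0, List.count_map_of_injective _ _ (rv_inj _)]
    exact hw.2

lemma WW_two : WW 2 = {[0, 1], [1, 0]} := by
  ext w
  rw [mem_WW]
  simp only [Finset.mem_insert, Finset.mem_singleton]
  constructor
  · rintro ⟨⟨h, -⟩, hl⟩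
    obtain ⟨a, b, rfl⟩ := List.length_eq_two.1 hl
    have h0 := h 0
    have h1 := h 1
    simp at h0 h1
    simp; omega
  · have h1 : ∀ x y : ℕ, x < 2 → y < 2 → x ≠ y → (x + 1 = y ∨ y + 1 = x) := by
      intros; omega
    rintro (rfl | rfl)
    · refine ⟨⟨fun x => by simp; omega, fun x y hx hy hxy =>
        ⟨fun _ => ?_, fun _ => h1 x y hx hy hxy⟩⟩, rfl⟩
      interval_cases x <;> interval_cases y <;> first | omega | exact alt_single (by decide) (by decide)
    · refine ⟨⟨fun x => by simp; omega, fun x y hx hy hxy =>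
        ⟨fun _ => ?_, fun _ => h1 x y hx hy hxy⟩⟩, rfl⟩
      interval_cases x <;> interval_cases y <;> first | omega | exact alt_single (by decide) (by decide)

lemma SS_zero : SS 0 = 2 := by
  unfold SS
  rw [show 0 + 2 = 2 by rfl, WW_two]
  decide

lemma DD_zero : DD 0 = 0 := by
  unfold DD
  rw [show 0 + 2 = 2 by rfl, WW_two]
  decide

lemma FF_one : FF 1 = 2 := by
  rw [show (1 : ℕ) = 0 + 1 by rfl, FF_rec, show 0 + 2 = 2 by rfl, WW_two]
  decide

lemma FF_val (k : ℕ) : FF (k + 1) = 2 ^ (k + 1) := by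
  induction k with
  | zero => exact FF_one
  | succ k ih => rw [FF_succ, ih]; ring

lemma DD_val (k : ℕ) : DD (k + 1) = (k + 2) * 2 ^ k := by
  induction k with
  | zero => rw [DD_succ, SS_zero, DD_zero]; norm_num
  | succ k ih => rw [DD_succ, ih, SS_eq_FF, FF_val]; ring

lemma card_val (k : ℕ) : (WW (k + 3)).card = (k + 4) * 2 ^ k := by
  rw [show k + 3 = (k + 1) + 2 by omega, card_WW, SS_eq_FF, FF_val, DD_val]; ring

lemma rep_iff {k : ℕ} (w : List (Fin k)) :
    Represents (pathGraph' k) w ↔ PP k (w.map Fin.val) := by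
  unfold Represents PP
  have hadj : ∀ x y : Fin k, x ≠ y →
      ((pathGraph' k).Adj x y ↔ ((x : ℕ) + 1 = y ∨ (y : ℕ) + 1 = x)) := by
    intro x y hxy
    simp [pathGraph', hxy]
  constructor
  · rintro ⟨h1, h2⟩
    refine ⟨fun x => ⟨?_, fun hx => ?_⟩, fun x y hx hy hxy => ?_⟩
    · intro hx
      obtain ⟨a, -, rfl⟩ := List.mem_map.1 hx
      exact a.2
    · exact List.mem_map.2 ⟨⟨x, hx⟩, h1 _, rfl⟩
    · have hne : (⟨x, hx⟩ : Fin k) ≠ ⟨y, hy⟩ := by simpa using hxy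
      have := h2 ⟨x, hx⟩ ⟨y, hy⟩ hne
      rw [hadj _ _ hne, ← alt_map Fin.val Fin.val_injective w] at this
      exact this
  · rintro ⟨h1, h2⟩
    refine ⟨fun v => ?_, fun x y hxy => ?_⟩
    · exact (List.mem_map_of_injective Fin.val_injective).1 ((h1 v).2 v.2)
    · rw [hadj x y hxy, ← alt_map Fin.val Fin.val_injective w]
      exact h2 x y x.2 y.2 (Fin.val_injective.ne hxy)

lemma image_eq (k : ℕ) :
    (List.map Fin.val) '' {w : List (Fin k) | Represents (pathGraph' k) w ∧ w.length = 2 * k - 2}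
      = (WW k : Set (List ℕ)) := by
  ext w
  simp only [Set.mem_image, Set.mem_ofPred_eq, Finset.mem_coe, mem_WW]
  constructor
  · rintro ⟨v, ⟨h1, h2⟩, rfl⟩
    exact ⟨(rep_iff v).1 h1, by simpa using h2⟩
  · rintro ⟨h, hl⟩
    have e : (w.pmap (fun x hx => (⟨x, hx⟩ : Fin k)) (fun x hx => (h.1 x).1 hx)).map Fin.val
        = w := by
      simp [List.map_pmap]
    exact ⟨_, ⟨(rep_iff _).2 (by rw [e]; exact h), by simpa using hl⟩, e⟩

/-- For the path graph `P_k` with `k ≥ 3`, the minimal length of a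
word-representant is `2k − 2`, and the number of word-representants of this minimal length
is `(k + 1) · 2^(k − 3)`. -/
theorem path_count_min_reps (k : ℕ) (hk : 3 ≤ k) :
    minRepLength (pathGraph' k) = 2 * k - 2 ∧
    {w : List (Fin k) | Represents (pathGraph' k) w ∧ w.length = 2 * k - 2}.ncard =
      (k + 1) * 2 ^ (k - 3) := by
  have hcard : {w : List (Fin k) | Represents (pathGraph' k) w ∧ w.length = 2 * k - 2}.ncard =
      (k + 1) * 2 ^ (k - 3) := by
    rw [← Set.ncard_image_of_injective _ (List.map_injective_iff.2 Fin.val_injective), image_eq,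
      Set.ncard_coe_finset]
    obtain ⟨m, rfl⟩ := Nat.exists_eq_add_of_le' hk
    rw [card_val]
    simp
  refine ⟨?_, hcard⟩
  have hne : {w : List (Fin k) | Represents (pathGraph' k) w ∧ w.length = 2 * k - 2}.Nonempty := by
    apply Set.nonempty_of_ncard_ne_zero
    rw [hcard]
    positivity
  obtain ⟨w, hw⟩ := hne
  unfold minRepLength
  apply IsLeast.csInf_eq
  refine ⟨⟨w, hw⟩, ?_⟩
  rintro n ⟨v, hv, rfl⟩
  have := len_ge ((rep_iff v).1 hv)
  simpa using this
end

section
/- Let C_n be the cycle graph on n ≥ 3 vertices. Then n(C_n) = 2n; that is, the number of words of minimal length ℓ(C_n) that word-represent C_n equals 2n. -/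
variable {V : Type*}

/-- The cycle graph `C_n` on vertex set `Fin n`, with an edge between `i` and `i + 1`
(indices modulo `n`). -/
def cycleGraph (n : ℕ) : SimpleGraph (Fin n) :=
  SimpleGraph.fromRel fun i j => (i.val + 1) % n = j.val


/-- Alternation of two letters, in terms of their first and last positions. -/
def AltPos (f l : ℕ → ℕ) (i j : ℕ) : Prop :=
  (f i < l i → (f i < f j ∧ f j < l i) ∨ (f i < l j ∧ l j < l i)) ∧
  (f j < l j → (f j < f i ∧ f i < l j) ∨ (f j < l i ∧ l i < l j))

lemma chain_order (m : ℕ) (hm : 3 ≤ m) (f l : ℕ → ℕ)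
    (h0 : f 0 = l 0) (hmm : f m = l m) (hlt : ∀ i, 0 < i → i < m → f i < l i)
    (hd : ∀ i j, i < j → j ≤ m → f i ≠ f j ∧ f i ≠ l j ∧ l i ≠ f j ∧ l i ≠ l j)
    (hA : ∀ i j, i < j → j ≤ m → (AltPos f l i j ↔ (j = i + 1 ∨ (i = 0 ∧ j = m))))
    (h0m : f 0 < f m) :
    ∀ i < m, f (i + 1) < l i ∧ (i + 2 ≤ m → l i < f (i + 2)) := by
  have hle : ∀ i, i ≤ m → f i ≤ l i := by
    intro i hi
    rcases Nat.eq_zero_or_pos i with rfl | h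
    · omega
    · rcases Nat.lt_or_ge i m with hh | hh
      · exact (hlt i h hh).le
      · have : i = m := by omega
        subst this; omega
  -- consecutive intervals meet
  have meet : ∀ i, i < m → f i < l (i + 1) ∧ f (i + 1) < l i := by
    intro i hi
    have h1 := (hA i (i + 1) (by omega) (by omega)).2 (Or.inl rfl)
    have h2 := hd i (i + 1) (by omega) (by omega)
    have h3 := hle i (by omega)
    have h4 := hle (i + 1) (by omega)
    obtain ⟨h5, h6⟩ := h1
    have h7 : f i < l i ∨ f (i + 1) < l (i + 1) := by
      rcases Nat.eq_zero_or_pos i with rfl | h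
      · right; exact hlt _ (by omega) (by omega)
      · left; exact hlt _ h hi
    omega
  have nestL : ∀ i, 0 < i → i < m → ¬ (f (i + 1) < f i ∧ l i < l (i + 1)) := by
    intro i hi him h
    have h1 := (hA i (i + 1) (by omega) (by omega)).2 (Or.inl rfl)
    have h2 := h1.1 (hlt i hi him)
    have := hle (i + 1) (by omega)
    omega
  have nestR : ∀ i, i + 1 < m → ¬ (f i < f (i + 1) ∧ l (i + 1) < l i) := by
    intro i him h
    have h1 := (hA i (i + 1) (by omega) (by omega)).2 (Or.inl rfl)
    have h2 := h1.2 (hlt (i + 1) (by omega) him)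
    have := hle i (by omega)
    omega
  have N : ∀ i j, i + 2 ≤ j → j ≤ m → l i < f j ∨ l j < f i ∨ (f i < f j ∧ l j < l i) ∨
      (f j < f i ∧ l i < l j) := by
    intro i j hij hj
    by_cases h : i = 0 ∧ j = m
    · obtain ⟨rfl, rfl⟩ := h; left; omega
    · have h1 := (hA i j (by omega) hj).not.2 (by omega)
      have h2 := hd i j (by omega) hj
      have h3 := hle i (by omega)
      have h4 := hle j (by omega)
      unfold AltPos at h1
      by_contra hc
      apply h1
      constructor <;> intro h <;> omega
  have s1 : ∀ i j, i + 2 ≤ j → j ≤ m → ¬ (f j < f i ∧ l i < l j) := by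
    intro i
    induction i with
    | zero =>
      intro j hj hjm h
      have h1 := hle j hjm
      by_cases hjm' : j = m
      · subst hjm'; omega
      · have h2 := (hA 0 j (by omega) hjm).1
          ⟨fun h => by omega, fun _ => Or.inl ⟨h.1, by omega⟩⟩
        omega
    | succ i ih =>
      intro j hj hjm h
      have h1 := N i j (by omega) hjm
      have h2 := ih j (by omega) hjm
      have h3 := meet i (by omega)
      have h4 := nestR i (by omega)
      omega
  have s2 : ∀ k i j, j + k = m → i + 2 ≤ j → ¬ (f i < f j ∧ l j < l i) := by
    intro k
    induction k with
    | zero =>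
      intro i j hj hij h
      have : j = m := by omega
      subst this
      have h1 := hle i (by omega)
      by_cases hi : i = 0
      · subst hi; omega
      · have h2 := (hA i j (by omega) le_rfl).1
          ⟨fun _ => Or.inl ⟨h.1, by omega⟩, fun h => by omega⟩
        omega
    | succ k ih =>
      intro i j hj hij h
      have h1 := N i (j + 1) (by omega) (by omega)
      have h2 := ih i (j + 1) (by omega) (by omega)
      have h3 := meet j (by omega)
      have h4 := nestL j (by omega) (by omega)
      omega
  have D : ∀ i j, i + 2 ≤ j → j ≤ m → l i < f j ∨ l j < f i := by
    intro i j hij hj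
    have h1 := N i j hij hj
    have h2 := s1 i j hij hj
    have h3 := s2 (m - j) i j (by omega) hij
    tauto
  have s4 : ∀ k j, j + k = m → 2 ≤ j → l 0 < f j := by
    intro k
    induction k with
    | zero =>
      intro j hj h2
      have : j = m := by omega
      subst this; omega
    | succ k ih =>
      intro j hj h2
      have h3 := ih (j + 1) (by omega) (by omega)
      have h4 := D 0 j (by omega) (by omega)
      have h5 := meet j (by omega)
      omega
  have s5 : ∀ i, i + 2 ≤ m → l i < f (i + 2) := by
    intro i
    induction i with
    | zero => intro h; exact s4 (m - 2) 2 (by omega) le_rfl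
    | succ i ih =>
      intro h
      have h1 := ih (by omega)
      have h2 := D (i + 1) (i + 1 + 2) le_rfl h
      have h3 := meet (i + 2) (by omega)
      have h4 := meet i (by omega)
      have e : i + 1 + 2 = i + 2 + 1 := by omega
      rw [e] at h2 ⊢
      omega
  exact fun i hi => ⟨(meet i hi).2, s5 i⟩

lemma head_iff [DecidableEq V] (w : List V) (x y : V) (hxy : x ≠ y) :
    (∀ z ∈ (restrictWord w x y).head?, x ≠ z) ↔
      ∀ j : ℕ, w[j]? = some x → ∃ k : ℕ, k < j ∧ w[k]? = some y := by
  induction w with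
  | nil => simp [restrictWord]
  | cons a w ih =>
    by_cases hx : a = x
    · subst hx
      simp only [restrictWord, List.filter_cons]
      simp
      exact ⟨0, by simp⟩
    by_cases hy : a = y
    · subst hy
      simp only [restrictWord, List.filter_cons]
      simp [hxy]
      intro j hj
      refine ⟨0, ?_, by simp⟩
      rcases j with _ | j
      · simp [hx] at hj
      · omega
    · have : restrictWord (a :: w) x y = restrictWord w x y := by
        simp [restrictWord, hx, hy]
      rw [this, ih]
      constructor
      · intro h j hj
        rcases j with _ | j
        · simp [hx] at hj
        · obtain ⟨k, hk, hk'⟩ := h j (by simpa using hj)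
          exact ⟨k + 1, by omega, by simpa using hk'⟩
      · intro h j hj
        obtain ⟨k, hk, hk'⟩ := h (j + 1) (by simpa using hj)
        rcases k with _ | k
        · simp [hy] at hk'
        · exact ⟨k, by omega, by simpa using hk'⟩

lemma restrict_comm [DecidableEq V] (w : List V) (x y : V) :
    restrictWord w x y = restrictWord w y x := by
  unfold restrictWord
  congr 1
  ext z
  simp [or_comm]

lemma alternates_comm [DecidableEq V] (w : List V) (x y : V) :
    Alternates w x y ↔ Alternates w y x := by
  unfold Alternates
  rw [restrict_comm]

/-- Between any two occurrences of `x` there is an occurrence of `y`. -/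
def SepIn (w : List V) (x y : V) : Prop :=
  ∀ i j : ℕ, i < j → w[i]? = some x → w[j]? = some x → ∃ k, i < k ∧ k < j ∧ w[k]? = some y

lemma sep_cons_ne (w : List V) (a x y : V) (h : a ≠ x) :
    SepIn (a :: w) x y ↔ SepIn w x y := by
  constructor
  · intro hs i j hij hi hj
    obtain ⟨k, h1, h2, h3⟩ := hs (i + 1) (j + 1) (by omega) (by simpa using hi) (by simpa using hj)
    rcases k with _ | k
    · omega
    · exact ⟨k, by omega, by omega, by simpa using h3⟩
  · intro hs i j hij hi hj
    rcases i with _ | i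
    · simp [h] at hi
    rcases j with _ | j
    · omega
    obtain ⟨k, h1, h2, h3⟩ := hs i j (by omega) (by simpa using hi) (by simpa using hj)
    exact ⟨k + 1, by omega, by omega, by simpa using h3⟩

lemma sep_cons_eq (w : List V) (x y : V) :
    SepIn (x :: w) x y ↔
      (∀ j : ℕ, w[j]? = some x → ∃ k : ℕ, k < j ∧ w[k]? = some y) ∧ SepIn w x y := by
  constructor
  · intro hs
    refine ⟨?_, ?_⟩
    · intro j hj
      obtain ⟨k, h1, h2, h3⟩ := hs 0 (j + 1) (by omega) (by simp) (by simpa using hj)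
      rcases k with _ | k
      · omega
      · exact ⟨k, by omega, by simpa using h3⟩
    intro i j hij hi hj
    obtain ⟨k, h1, h2, h3⟩ := hs (i + 1) (j + 1) (by omega) (by simpa using hi) (by simpa using hj)
    rcases k with _ | k
    · omega
    · exact ⟨k, by omega, by omega, by simpa using h3⟩
  · rintro ⟨hs0, hs⟩ i j hij hi hj
    rcases j with _ | j
    · omega
    rcases i with _ | i
    · obtain ⟨k, h2, h3⟩ := hs0 j (by simpa using hj)
      exact ⟨k + 1, by omega, by omega, by simpa using h3⟩
    obtain ⟨k, h1, h2, h3⟩ := hs i j (by omega) (by simpa using hi) (by simpa using hj)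
    exact ⟨k + 1, by omega, by omega, by simpa using h3⟩

lemma alternates_def [DecidableEq V] (w : List V) (x y : V) :
    Alternates w x y ↔ List.IsChain (· ≠ ·) (restrictWord w x y) := Iff.rfl

lemma alternates_iff [DecidableEq V] (w : List V) (x y : V) (hxy : x ≠ y) :
    Alternates w x y ↔ SepIn w x y ∧ SepIn w y x := by
  induction w with
  | nil => simp [alternates_def, restrictWord, SepIn]
  | cons a w ih =>
    by_cases hx : a = x
    · subst hx
      rw [sep_cons_eq, sep_cons_ne _ _ _ _ hxy, ← head_iff w a y hxy, and_assoc, ← ih]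
      have : restrictWord (a :: w) a y = a :: restrictWord w a y := by
        simp [restrictWord]
      rw [alternates_def, alternates_def, this, List.isChain_cons]
    by_cases hy : a = y
    · subst hy
      rw [sep_cons_eq, sep_cons_ne _ _ _ _ hx, ← head_iff w a x hx, and_left_comm, ← ih]
      have : restrictWord (a :: w) x a = a :: restrictWord w x a := by
        simp [restrictWord]
      rw [alternates_def, alternates_def, this, List.isChain_cons, restrict_comm w a x]
    · have : restrictWord (a :: w) x y = restrictWord w x y := by
        simp [restrictWord, hx, hy]
      rw [sep_cons_ne _ _ _ _ hx, sep_cons_ne _ _ _ _ hy, ← ih]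
      unfold Alternates
      rw [this]

lemma count_zero_pos [DecidableEq V] (w : List V) (x : V) (h : w.count x = 0) (k : ℕ) :
    w[k]? ≠ some x := by
  intro hk
  exact List.count_eq_zero.1 h (List.mem_of_getElem? hk)

lemma count_one_pos [DecidableEq V] (w : List V) (x : V) (h : w.count x = 1) :
    ∃ p : ℕ, ∀ k : ℕ, w[k]? = some x ↔ k = p := by
  induction w with
  | nil => simp at h
  | cons a w ih =>
    by_cases ha : a = x
    · subst ha
      simp at h
      refine ⟨0, ?_⟩
      rintro (_ | k)
      · simp
      · simpa using count_zero_pos w a h k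
    · rw [List.count_cons_of_ne ha] at h
      obtain ⟨p, hp⟩ := ih h
      refine ⟨p + 1, ?_⟩
      rintro (_ | k)
      · simp [ha]
      · simpa using hp k

lemma count_two_pos [DecidableEq V] (w : List V) (x : V) (h : w.count x = 2) :
    ∃ p q : ℕ, p < q ∧ ∀ k : ℕ, w[k]? = some x ↔ (k = p ∨ k = q) := by
  induction w with
  | nil => simp at h
  | cons a w ih =>
    by_cases ha : a = x
    · subst ha
      rw [List.count_cons_self] at h
      obtain ⟨p, hp⟩ := count_one_pos w a (by omega)
      refine ⟨0, p + 1, by omega, ?_⟩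
      rintro (_ | k)
      · simp
      · simpa using hp k
    · rw [List.count_cons_of_ne ha] at h
      obtain ⟨p, q, hpq, hp⟩ := ih h
      refine ⟨p + 1, q + 1, by omega, ?_⟩
      rintro (_ | k)
      · simp [ha]
      · simpa using hp k

/-- The vertices of the cycle enumerated from `c` in one of the two directions. -/
def vtx {m : ℕ} (c : Fin (m + 1)) (s : Bool) (i : ℕ) : Fin (m + 1) :=
  ⟨(if s then c.val + i else c.val + (m + 1) - i) % (m + 1), Nat.mod_lt _ (Nat.succ_pos m)⟩

lemma mod_if (n x : ℕ) (h : x < 2 * n) : x % n = if x < n then x else x - n := by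
  split_ifs with h1
  · exact Nat.mod_eq_of_lt h1
  · rw [Nat.mod_eq_sub_mod (by omega), Nat.mod_eq_of_lt (by omega)]

lemma vtx_true {m : ℕ} (c : Fin (m + 1)) (i : ℕ) (hi : i ≤ m) :
    (vtx c true i).val = if c.val + i ≤ m then c.val + i else c.val + i - (m + 1) := by
  have := c.isLt
  simp only [vtx, if_true]
  rw [mod_if _ _ (by omega)]
  split_ifs <;> omega

lemma vtx_false {m : ℕ} (c : Fin (m + 1)) (i : ℕ) (hi : i ≤ m) :
    (vtx c false i).val = if i ≤ c.val then c.val - i else c.val + (m + 1) - i := by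
  have := c.isLt
  simp only [vtx, Bool.false_eq_true, if_false]
  rcases Nat.eq_zero_or_pos i with rfl | h
  · simp [Nat.mod_eq_of_lt c.isLt]
  rw [mod_if _ _ (by omega)]
  split_ifs <;> omega

lemma adj_iff {m : ℕ} (hm : 2 ≤ m) (a b : Fin (m + 1)) :
    (cycleGraph (m + 1)).Adj a b ↔ a.val + 1 = b.val ∨ b.val + 1 = a.val ∨
      (a.val = 0 ∧ b.val = m) ∨ (a.val = m ∧ b.val = 0) := by
  have h1 := a.isLt
  have h2 := b.isLt
  rw [cycleGraph, SimpleGraph.fromRel_adj, mod_if _ _ (by omega), mod_if _ _ (by omega),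
    Ne, Fin.ext_iff]
  split_ifs <;> omega

lemma vtx_adj {m : ℕ} (hm : 2 ≤ m) (c : Fin (m + 1)) (s : Bool) (i j : ℕ) (hij : i < j)
    (hj : j ≤ m) :
    (cycleGraph (m + 1)).Adj (vtx c s i) (vtx c s j) ↔ (j = i + 1 ∨ (i = 0 ∧ j = m)) := by
  have := c.isLt
  rw [adj_iff hm]
  cases s
  · rw [vtx_false c i (by omega), vtx_false c j hj]
    split_ifs <;> omega
  · rw [vtx_true c i (by omega), vtx_true c j hj]
    split_ifs <;> omega

lemma vtx_inj {m : ℕ} (c : Fin (m + 1)) (s : Bool) (i j : ℕ) (hi : i ≤ m)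
    (hj : j ≤ m) (h : vtx c s i = vtx c s j) : i = j := by
  have := c.isLt
  rw [Fin.ext_iff] at h
  cases s
  · rw [vtx_false c i hi, vtx_false c j hj] at h
    split_ifs at h <;> omega
  · rw [vtx_true c i hi, vtx_true c j hj] at h
    split_ifs at h <;> omega

lemma vtx_surj {m : ℕ} (c : Fin (m + 1)) (s : Bool) (x : Fin (m + 1)) :
    ∃ i, i ≤ m ∧ vtx c s i = x := by
  have h1 := c.isLt
  have h2 := x.isLt
  cases s
  · by_cases h : x.val ≤ c.val
    · refine ⟨c.val - x.val, by omega, ?_⟩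
      rw [Fin.ext_iff, vtx_false _ _ (by omega)]
      split_ifs <;> omega
    · refine ⟨c.val + (m + 1) - x.val, by omega, ?_⟩
      rw [Fin.ext_iff, vtx_false _ _ (by omega)]
      split_ifs <;> omega
  · by_cases h : c.val ≤ x.val
    · refine ⟨x.val - c.val, by omega, ?_⟩
      rw [Fin.ext_iff, vtx_true _ _ (by omega)]
      split_ifs <;> omega
    · refine ⟨x.val + (m + 1) - c.val, by omega, ?_⟩
      rw [Fin.ext_iff, vtx_true _ _ (by omega)]
      split_ifs <;> omega

/-- The minimal words `v₁ v₀ v₂ v₁ v₃ v₂ …`. -/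
def wd {m : ℕ} (c : Fin (m + 1)) (s : Bool) : List (Fin (m + 1)) :=
  List.ofFn (n := 2 * m) fun k => vtx c s (k.val / 2 + 1 - k.val % 2)

lemma wd_length {m : ℕ} (c : Fin (m + 1)) (s : Bool) : (wd c s).length = 2 * m := by
  simp [wd]

lemma wd_get {m : ℕ} (c : Fin (m + 1)) (s : Bool) (k : ℕ) (hk : k < 2 * m) :
    (wd c s)[k]? = some (vtx c s (k / 2 + 1 - k % 2)) := by
  simp [wd, hk]

lemma wd_get_iff {m : ℕ} (c : Fin (m + 1)) (s : Bool) (k i : ℕ) (hi : i ≤ m) :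
    (wd c s)[k]? = some (vtx c s i) ↔ k < 2 * m ∧ k / 2 + 1 - k % 2 = i := by
  by_cases hk : k < 2 * m
  · rw [wd_get c s k hk]
    simp only [Option.some.injEq, hk, true_and]
    refine ⟨fun h => vtx_inj c s _ _ (by omega) hi h, fun h => by rw [h]⟩
  · simp only [hk, false_and, iff_false]
    rw [List.getElem?_eq_none (by rw [wd_length]; omega)]
    simp

lemma represents_wd {m : ℕ} (hm : 3 ≤ m) (c : Fin (m + 1)) (s : Bool) :
    Represents (cycleGraph (m + 1)) (wd c s) := by
  have key : ∀ i j, i < j → j ≤ m → ((cycleGraph (m + 1)).Adj (vtx c s i) (vtx c s j) ↔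
      Alternates (wd c s) (vtx c s i) (vtx c s j)) := by
    intro i j hij hj
    rw [vtx_adj (by omega) c s i j hij hj, alternates_iff]
    swap
    · intro h
      have := vtx_inj c s i j (by omega) hj h
      omega
    unfold SepIn
    simp only [wd_get_iff c s _ i (by omega), wd_get_iff c s _ j hj]
    constructor
    · rintro (rfl | ⟨rfl, rfl⟩)
      · constructor
        · intro a b hab ha hb
          exact ⟨2 * i, by omega, by omega, by omega, by omega⟩
        · intro a b hab ha hb
          exact ⟨2 * i + 1, by omega, by omega, by omega, by omega⟩
      · constructor
        · intro a b hab ha hb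
          omega
        · intro a b hab ha hb
          omega
    · rintro ⟨h1, h2⟩
      by_contra hc
      by_cases hi : i = 0
      · obtain ⟨k, hk⟩ := h2 (2 * j - 2) (2 * j + 1) (by omega) (by omega) (by omega)
        omega
      · obtain ⟨k, hk⟩ := h1 (2 * i - 2) (2 * i + 1) (by omega) (by omega) (by omega)
        omega
  constructor
  · intro x
    obtain ⟨i, hi, rfl⟩ := vtx_surj c s x
    by_cases h : i = 0
    · exact List.mem_of_getElem? ((wd_get_iff c s 1 i hi).2 (by omega))
    · exact List.mem_of_getElem? ((wd_get_iff c s (2 * i - 2) i hi).2 (by omega))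
  · intro x y hxy
    obtain ⟨i, hi, rfl⟩ := vtx_surj c s x
    obtain ⟨j, hj, rfl⟩ := vtx_surj c s y
    rcases Nat.lt_trichotomy i j with h | h | h
    · exact key i j h hj
    · subst h; exact absurd rfl hxy
    · rw [SimpleGraph.adj_comm, alternates_comm]
      exact key j i h hi

lemma wd_inj {m : ℕ} (hm : 2 ≤ m) (c cc : Fin (m + 1)) (s ss : Bool)
    (h : wd c s = wd cc ss) : c = cc ∧ s = ss := by
  have h1 := wd_get c s 1 (by omega)
  have h0 := wd_get c s 0 (by omega)
  rw [h, wd_get cc ss 1 (by omega)] at h1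
  rw [h, wd_get cc ss 0 (by omega)] at h0
  simp only [Option.some.injEq, Fin.ext_iff] at h1 h0
  norm_num at h1 h0
  have := c.isLt
  have := cc.isLt
  rw [Fin.ext_iff]
  cases s <;> cases ss <;> simp only [vtx_true _ 0 (Nat.zero_le m), vtx_false _ 0 (Nat.zero_le m),
    vtx_true _ 1 (show 1 ≤ m by omega), vtx_false _ 1 (show 1 ≤ m by omega)] at h1 h0 <;>
    simp <;> split_ifs at h1 h0 <;> omega

/-- Count facts: length bound, and the shape of the counts in the extremal case. -/
lemma count_facts {m : ℕ} (hm : 3 ≤ m) (w : List (Fin (m + 1)))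
    (hw : Represents (cycleGraph (m + 1)) w) :
    2 * m ≤ w.length ∧ (w.length = 2 * m → ∃ a b, a ≠ b ∧
      (cycleGraph (m + 1)).Adj a b ∧ w.count a = 1 ∧ w.count b = 1 ∧
      ∀ x, x ≠ a → x ≠ b → w.count x = 2) := by
  classical
  obtain ⟨hmem, hadj⟩ := hw
  have single : ∀ a b, a ≠ b → w.count a = 1 → w.count b = 1 →
      (cycleGraph (m + 1)).Adj a b := by
    intro a b hab ha hb
    rw [hadj a b hab, alternates_iff w a b hab]
    obtain ⟨p, hp⟩ := count_one_pos w a ha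
    obtain ⟨q, hq⟩ := count_one_pos w b hb
    constructor
    · intro i j hij hi hj
      rw [hp] at hi hj; omega
    · intro i j hij hi hj
      rw [hq] at hi hj; omega
  set S : Finset (Fin (m + 1)) := Finset.univ.filter fun x => w.count x = 1 with hS
  have hcard : S.card ≤ 2 := by
    by_contra hc
    push Not at hc
    obtain ⟨a, ha, b, hb, c, hc, hab, hac, hbc⟩ := Finset.two_lt_card.1 hc
    simp only [hS, Finset.mem_filter, Finset.mem_univ, true_and] at ha hb hc
    have h1 := single a b hab ha hb
    have h2 := single a c hac ha hc
    have h3 := single b c hbc hb hc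
    rw [adj_iff (by omega)] at h1 h2 h3
    omega
  have hpos : ∀ x, 1 ≤ w.count x := fun x => List.one_le_count_iff.2 (hmem x)
  have hlen : ∑ x, w.count x = w.length := by
    have := List.sum_toFinset_count_eq_length w
    rw [← this]
    apply Finset.sum_congr _ (fun _ _ => rfl)
    ext x; simp [hmem x]
  have hS' : ∑ x : Fin (m + 1), (if w.count x = 1 then 1 else 0) = S.card := by
    rw [hS, Finset.card_filter]
  have h2 : ∀ x ∈ Finset.univ, 2 ≤ w.count x + (if w.count x = 1 then 1 else 0) := by
    intro x _
    have := hpos x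
    split_ifs <;> omega
  have hsum : ∑ x : Fin (m + 1), (w.count x + (if w.count x = 1 then 1 else 0)) =
      w.length + S.card := by
    rw [Finset.sum_add_distrib, hlen, hS']
  have htwo : ∑ x : Fin (m + 1), 2 = 2 * (m + 1) := by
    simp [mul_comm]
  have hle := Finset.sum_le_sum h2
  rw [hsum, htwo] at hle
  refine ⟨by omega, ?_⟩
  intro hl
  have hc2 : S.card = 2 := by omega
  have heq := (Finset.sum_eq_sum_iff_of_le h2).1 (by rw [hsum, htwo]; omega)
  obtain ⟨a, b, hab, hSab⟩ := Finset.card_eq_two.1 hc2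
  have hin : ∀ x, w.count x = 1 ↔ (x = a ∨ x = b) := by
    intro x
    have : x ∈ S ↔ x ∈ ({a, b} : Finset _) := by rw [hSab]
    simpa [hS] using this
  have ha := (hin a).2 (Or.inl rfl)
  have hb := (hin b).2 (Or.inr rfl)
  refine ⟨a, b, hab, single a b hab ha hb, ha, hb, ?_⟩
  intro x hxa hxb
  have h := heq x (Finset.mem_univ x)
  have hne : w.count x ≠ 1 := by rw [Ne, hin]; tauto
  rw [if_neg hne] at h
  omega

lemma exists_dir {m : ℕ} (hm : 3 ≤ m) (a b : Fin (m + 1))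
    (h : (cycleGraph (m + 1)).Adj a b) : ∃ s, vtx a s 0 = a ∧ vtx a s m = b := by
  have := a.isLt
  have := b.isLt
  rw [adj_iff (by omega)] at h
  by_cases hh : a.val + 1 = b.val ∨ (a.val = m ∧ b.val = 0)
  · refine ⟨false, ?_, ?_⟩ <;> rw [Fin.ext_iff, vtx_false _ _ (by omega)] <;> split_ifs <;> omega
  · refine ⟨true, ?_, ?_⟩ <;> rw [Fin.ext_iff, vtx_true _ _ (by omega)] <;> split_ifs <;> omega

lemma unique_word {m : ℕ} (hm : 3 ≤ m) (w : List (Fin (m + 1)))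
    (hw : Represents (cycleGraph (m + 1)) w) (hl : w.length = 2 * m) :
    ∃ c s, w = wd c s := by
  classical
  obtain ⟨a, b, hab, hadj, ha, hb, hrest⟩ := (count_facts hm w hw).2 hl
  have hpos : ∀ x : Fin (m + 1), ∃ p q : ℕ, (∀ k : ℕ, w[k]? = some x ↔ (k = p ∨ k = q)) ∧
      (w.count x = 1 → p = q) ∧ (w.count x = 2 → p < q) := by
    intro x
    by_cases h1 : w.count x = 1
    · obtain ⟨p, hp⟩ := count_one_pos w x h1
      exact ⟨p, p, by simpa using hp, fun _ => rfl, fun h => by omega⟩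
    · have h2 : w.count x = 2 :=
        hrest x (by rintro rfl; exact h1 ha) (by rintro rfl; exact h1 hb)
      obtain ⟨p, q, hpq, hp⟩ := count_two_pos w x h2
      exact ⟨p, q, hp, fun h => by omega, fun _ => hpq⟩
  choose F L hFL h1 h2 using hpos
  -- choose the single letter that comes first
  wlog hlt : F a < F b generalizing a b
  · refine this b a hab.symm hadj.symm hb ha (fun x hx hy => hrest x hy hx) ?_
    have : F a ≠ F b := by
      intro he
      have e1 := (hFL a (F a)).2 (Or.inl rfl)
      have e2 := (hFL b (F b)).2 (Or.inl rfl)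
      rw [he, e2] at e1
      exact hab (Option.some.inj e1).symm
    omega
  obtain ⟨s, hs0, hsm⟩ := exists_dir hm a b hadj
  refine ⟨a, s, ?_⟩
  set f : ℕ → ℕ := fun i => F (vtx a s i) with hf
  set l : ℕ → ℕ := fun i => L (vtx a s i) with hldef
  have hpos : ∀ i k, w[k]? = some (vtx a s i) ↔ (k = f i ∨ k = l i) := fun i k => hFL _ k
  have hfw : ∀ i, w[f i]? = some (vtx a s i) := fun i => (hpos i _).2 (Or.inl rfl)
  have hlw : ∀ i, w[l i]? = some (vtx a s i) := fun i => (hpos i _).2 (Or.inr rfl)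
  have hne : ∀ i j, i < j → j ≤ m → vtx a s i ≠ vtx a s j := by
    intro i j hij hj h
    have := vtx_inj a s i j (by omega) hj h
    omega
  have hsepne : ∀ i j p q : ℕ, i < j → j ≤ m → w[p]? = some (vtx a s i) →
      w[q]? = some (vtx a s j) → p ≠ q := by
    rintro i j p q hij hj hp hq rfl
    rw [hp] at hq
    exact hne i j hij hj (Option.some.inj hq)
  have e0 : f 0 = l 0 := by
    simp only [hf, hldef]; rw [hs0]; exact h1 a ha
  have em : f m = l m := by
    simp only [hf, hldef]; rw [hsm]; exact h1 b hb
  have eo : ∀ i, 0 < i → i < m → f i < l i := by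
    intro i hi him
    apply h2
    apply hrest
    · intro h; exact hne 0 i hi him.le (hs0.trans h.symm)
    · rw [← hsm]; exact hne i m him le_rfl
  have hle : ∀ i, i ≤ m → f i ≤ l i := by
    intro i hi
    rcases Nat.eq_zero_or_pos i with rfl | h
    · exact e0.le
    · rcases Nat.lt_or_ge i m with hh | hh
      · exact (eo i h hh).le
      · have : i = m := by omega
        rw [this]; exact em.le
  have hsep : ∀ i j, i ≤ m → (SepIn w (vtx a s i) (vtx a s j) ↔
      (f i < l i → (f i < f j ∧ f j < l i) ∨ (f i < l j ∧ l j < l i))) := by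
    intro i j hi
    unfold SepIn
    simp only [hpos]
    constructor
    · intro h hlt
      obtain ⟨k, hk1, hk2, rfl | rfl⟩ := h _ _ hlt (Or.inl rfl) (Or.inr rfl)
      · exact Or.inl ⟨hk1, hk2⟩
      · exact Or.inr ⟨hk1, hk2⟩
    · intro h p q hpq hp hq
      have := hle i hi
      have e1 : p = f i := by omega
      have e2 : q = l i := by omega
      subst e1 e2
      rcases h hpq with h | h
      · exact ⟨f j, h.1, h.2, Or.inl rfl⟩
      · exact ⟨l j, h.1, h.2, Or.inr rfl⟩
  have main := chain_order m hm f l e0 em eo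
    (fun i j hij hj => ⟨hsepne i j _ _ hij hj (hfw i) (hfw j), hsepne i j _ _ hij hj (hfw i) (hlw j),
      hsepne i j _ _ hij hj (hlw i) (hfw j), hsepne i j _ _ hij hj (hlw i) (hlw j)⟩)
    (fun i j hij hj => by
      rw [← vtx_adj (by omega) a s i j hij hj, hw.2 _ _ (hne i j hij hj),
        alternates_iff _ _ _ (hne i j hij hj), hsep i j (by omega), hsep j i hj]
      rfl)
    (by simp only [hf]; rw [hs0, hsm]; exact hlt)
  -- positions form a strictly increasing sequence of full length
  set g : ℕ → ℕ := fun k => if k % 2 = 0 then f (k / 2 + 1) else l (k / 2) with hg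
  have gE : ∀ i, g (2 * i) = f (i + 1) := by
    intro i
    have e1 : 2 * i % 2 = 0 := by omega
    have e2 : 2 * i / 2 = i := by omega
    simp only [hg, e1, e2, if_true]
  have gO : ∀ i, g (2 * i + 1) = l i := by
    intro i
    have e1 : (2 * i + 1) % 2 = 1 := by omega
    have e2 : (2 * i + 1) / 2 = i := by omega
    simp only [hg, e1, e2, one_ne_zero, if_false]
  have gstep : ∀ k, k + 1 < 2 * m → g k < g (k + 1) := by
    intro k hk
    rcases Nat.even_or_odd' k with ⟨i, rfl | rfl⟩
    · rw [gE, gO]; exact (main i (by omega)).1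
    · rw [show 2 * i + 1 + 1 = 2 * (i + 1) by ring, gE, gO]
      exact (main i (by omega)).2 (by omega)
  have gw : ∀ k, k < 2 * m → w[g k]? = some (vtx a s (k / 2 + 1 - k % 2)) := by
    intro k hk
    rcases Nat.even_or_odd' k with ⟨i, rfl | rfl⟩
    · rw [gE, hfw]; congr 2; omega
    · rw [gO, hlw]; congr 2; omega
  have glt : ∀ k, k < 2 * m → g k < 2 * m := by
    intro k hk
    by_contra hc
    have := gw k hk
    rw [List.getElem?_eq_none (by omega)] at this
    simp at this
  have glow : ∀ k, k < 2 * m → k ≤ g k := by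
    intro k
    induction k with
    | zero => intro _; omega
    | succ k ih =>
      intro hk
      have := ih (by omega)
      have := gstep k hk
      omega
  have gup : ∀ d k, k + d + 1 = 2 * m → g k ≤ k := by
    intro d
    induction d with
    | zero =>
      intro k hk
      have := glt k (by omega)
      omega
    | succ d ih =>
      intro k hk
      have := ih (k + 1) (by omega)
      have := gstep k (by omega)
      omega
  apply List.ext_getElem?
  intro k
  by_cases hk : k < 2 * m
  · rw [wd_get a s k hk, ← gw k hk]
    have h3 := glow k hk
    have h4 := gup (2 * m - k - 1) k (by omega)
    rw [le_antisymm h4 h3]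
  · rw [List.getElem?_eq_none (by omega), List.getElem?_eq_none (by rw [wd_length]; omega)]

lemma case_three : {w : List (Fin 3) |
      Represents (cycleGraph 3) w ∧ w.length = minRepLength (cycleGraph 3)}.ncard = 2 * 3 := by
  have hrep : ∀ a b c : Fin 3, Represents (cycleGraph 3) [a, b, c] ↔
      (a ≠ b ∧ b ≠ c ∧ a ≠ c) := by
    unfold Represents
    simp only [adj_iff (m := 2) le_rfl, alternates_def]
    decide
  have hmin : minRepLength (cycleGraph 3) = 3 := by
    unfold minRepLength
    have hmem : 3 ∈ {n | ∃ w : List (Fin 3), Represents (cycleGraph 3) w ∧ w.length = n} :=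
      ⟨[0, 1, 2], (hrep 0 1 2).2 (by decide), rfl⟩
    apply le_antisymm
    · exact Nat.sInf_le hmem
    · apply le_csInf ⟨3, hmem⟩
      rintro k ⟨w, hw, rfl⟩
      have h1 : w.toFinset = Finset.univ := by
        ext x; simp [hw.1 x]
      have h2 := List.toFinset_card_le w
      rw [h1] at h2
      simpa using h2
  rw [hmin]
  have : {w : List (Fin 3) | Represents (cycleGraph 3) w ∧ w.length = 3} =
      (((Finset.univ : Finset (Fin 3 × Fin 3 × Fin 3)).filter
        fun t => t.1 ≠ t.2.1 ∧ t.2.1 ≠ t.2.2 ∧ t.1 ≠ t.2.2).image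
        fun t => [t.1, t.2.1, t.2.2] : Finset (List (Fin 3))) := by
    ext w
    simp only [Set.mem_ofPred_eq, Finset.coe_image, Set.mem_image, Finset.coe_filter,
      Finset.mem_univ, true_and]
    constructor
    · rintro ⟨hw, hl⟩
      obtain ⟨a, b, c, rfl⟩ := List.length_eq_three.1 hl
      exact ⟨(a, b, c), (hrep a b c).1 hw, rfl⟩
    · rintro ⟨⟨a, b, c⟩, h, rfl⟩
      exact ⟨(hrep a b c).2 h, rfl⟩
  rw [this, Set.ncard_coe_finset]
  decide

lemma case_big (m : ℕ) (hm : 3 ≤ m) : {w : List (Fin (m + 1)) |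
      Represents (cycleGraph (m + 1)) w ∧
        w.length = minRepLength (cycleGraph (m + 1))}.ncard = 2 * (m + 1) := by
  have hmin : minRepLength (cycleGraph (m + 1)) = 2 * m := by
    unfold minRepLength
    have hmem : 2 * m ∈ {n | ∃ w : List (Fin (m + 1)),
        Represents (cycleGraph (m + 1)) w ∧ w.length = n} :=
      ⟨wd 0 true, represents_wd hm 0 true, wd_length 0 true⟩
    apply le_antisymm
    · exact Nat.sInf_le hmem
    · apply le_csInf ⟨_, hmem⟩
      rintro k ⟨w, hw, rfl⟩
      exact (count_facts hm w hw).1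
  rw [hmin]
  have : {w : List (Fin (m + 1)) | Represents (cycleGraph (m + 1)) w ∧ w.length = 2 * m} =
      (fun t : Fin (m + 1) × Bool => wd t.1 t.2) '' Set.univ := by
    ext w
    simp only [Set.mem_ofPred_eq, Set.image_univ, Set.mem_range]
    constructor
    · rintro ⟨hw, hl⟩
      obtain ⟨c, s, h⟩ := unique_word hm w hw hl
      exact ⟨(c, s), h.symm⟩
    · rintro ⟨⟨c, s⟩, rfl⟩
      exact ⟨represents_wd hm c s, wd_length c s⟩
  rw [this, Set.ncard_image_of_injective, Set.ncard_univ]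
  · simp [mul_comm]
  · rintro ⟨c, s⟩ ⟨cc, ss⟩ h
    obtain ⟨rfl, rfl⟩ := wd_inj (by omega) c cc s ss h
    rfl

/-- For `n ≥ 3`, the number of word-representants of the cycle `C_n`
of minimal length `ℓ(C_n)` equals `2n`. -/
theorem cycle_count_min_reps (n : ℕ) (hn : 3 ≤ n) :
    {w : List (Fin n) |
      Represents (cycleGraph n) w ∧ w.length = minRepLength (cycleGraph n)}.ncard = 2 * n := by
  obtain ⟨m, rfl⟩ : ∃ m, n = m + 1 := ⟨n - 1, by omega⟩
  rcases Nat.lt_or_ge m 3 with h | h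
  · obtain rfl : m = 2 := by omega
    exact case_three
  · exact case_big m h
end
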